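/- (Bilinear embedding theorem.) Let w ∈ A₂^d with ‖w‖_{A₂^d} ≤ Q, and let {α_I}_{I∈D} be a sequence of nonnegative numbers such that for all J ∈ D: (1/|J|) Σ_{I∈D(J)} α_I (m_I w)(m_I w⁻¹) ≤ Q, (1/|J|) Σ_{I∈D(J)} α_I m_I w ≤ Q m_J w, and (1/|J|) Σ_{I∈D(J)} α_I m_I w⁻¹ ≤ Q m_J w⁻¹. Then there is an absolute constant C > 0 such that for all f, g ∈ L₂, Σ_{I∈D} α_I · m_I(f w^{-1/2}) · m_I(g w^{1/2}) ≤ C Q ‖f‖_{L₂} ‖g‖_{L₂}. -/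

import Mathlib

open MeasureTheory Set

noncomputable section

/-- The dyadic interval `[k 2^{-j}, (k+1) 2^{-j})`, indexed by `I = (j, k)`. -/
def dyadicI (I : ℤ × ℤ) : Set ℝ :=
  Set.Ico ((I.2 : ℝ) * 2 ^ (-I.1)) (((I.2 : ℝ) + 1) * 2 ^ (-I.1))

/-- The length `|I| = 2^{-j}` of the dyadic interval indexed by `I = (j, k)`. -/
def len (I : ℤ × ℤ) : ℝ := 2 ^ (-I.1)

/-- The left half `I⁺` of the dyadic interval `I`. -/
def leftHalf (I : ℤ × ℤ) : ℤ × ℤ := (I.1 + 1, 2 * I.2)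

/-- The right half `I⁻` of the dyadic interval `I`. -/
def rightHalf (I : ℤ × ℤ) : ℤ × ℤ := (I.1 + 1, 2 * I.2 + 1)

/-- The average `m_I f = (1/|I|) ∫_I f`. -/
def avg (f : ℝ → ℝ) (I : ℤ × ℤ) : ℝ := (len I)⁻¹ * ∫ x in dyadicI I, f x

/-- The Haar function `h_I = |I|^{-1/2} (χ_{I⁺} - χ_{I⁻})`. -/
def haar (I : ℤ × ℤ) (x : ℝ) : ℝ :=
  (Real.sqrt (len I))⁻¹ *
    ((dyadicI (leftHalf I)).indicator (fun _ => (1 : ℝ)) x -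
      (dyadicI (rightHalf I)).indicator (fun _ => (1 : ℝ)) x)

/-- The Haar coefficient `b_I = ⟨b, h_I⟩`. -/
def haarCoef (b : ℝ → ℝ) (I : ℤ × ℤ) : ℝ := ∫ x, b x * haar I x

/-- The dyadic BMO norm of `b`. -/
def bmoNorm (b : ℝ → ℝ) : ℝ :=
  Real.sqrt (⨆ I : ℤ × ℤ, (len I)⁻¹ * ∫ x in dyadicI I, (b x - avg b I) ^ 2)

/-- The `A₂^d` characteristic `‖w‖_{A₂^d} = sup_I (m_I w)(m_I w⁻¹)`. -/
def A2const (w : ℝ → ℝ) : ℝ :=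
  ⨆ I : ℤ × ℤ, avg w I * avg (fun x => (w x)⁻¹) I

open scoped ENNReal NNReal

theorem measurableSet_dyadicI (I : ℤ × ℤ) : MeasurableSet (dyadicI I) := measurableSet_Ico

theorem len_pos (I : ℤ × ℤ) : 0 < len I := by unfold len; positivity

theorem volume_dyadicI (I : ℤ × ℤ) : volume (dyadicI I) = ENNReal.ofReal (len I) := by
  rw [dyadicI, Real.volume_Ico, len]
  congr 1
  ring

/-- A dyadic interval that is not longer than another one is contained in it or disjoint
from it. -/
theorem dyadicI_subset_or_disjoint_of_le {I J : ℤ × ℤ} (h : J.1 ≤ I.1) :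
    dyadicI I ⊆ dyadicI J ∨ Disjoint (dyadicI I) (dyadicI J) := by
  obtain ⟨n, hn⟩ := Int.le.dest h
  have hd : (0 : ℝ) < 2 ^ (-I.1) := by positivity
  have hJ : (2 : ℝ) ^ (-J.1) = ((2 ^ n : ℤ) : ℝ) * 2 ^ (-I.1) := by
    rw [← hn]
    push_cast
    rw [← zpow_natCast, ← zpow_add₀ (by norm_num)]
    congr 1
    ring
  unfold dyadicI
  rw [hJ]
  set d : ℝ := 2 ^ (-I.1)
  set N : ℤ := 2 ^ n
  rcases lt_or_ge I.2 (J.2 * N) with h1 | h1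
  · right
    have h2 : ((I.2 + 1 : ℤ) : ℝ) ≤ ((J.2 * N : ℤ) : ℝ) := by exact_mod_cast h1
    push_cast at h2
    rw [Set.Ico_disjoint_Ico]
    refine (min_le_left _ _).trans (le_trans ?_ (le_max_right _ _))
    nlinarith
  rcases lt_or_ge I.2 ((J.2 + 1) * N) with h3 | h3
  · left
    have h2 : ((J.2 * N : ℤ) : ℝ) ≤ ((I.2 : ℤ) : ℝ) := by exact_mod_cast h1
    have h4 : ((I.2 + 1 : ℤ) : ℝ) ≤ (((J.2 + 1) * N : ℤ) : ℝ) := by exact_mod_cast h3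
    push_cast at h2 h4
    apply Set.Ico_subset_Ico
    · nlinarith
    · nlinarith
  · right
    have h2 : (((J.2 + 1) * N : ℤ) : ℝ) ≤ ((I.2 : ℤ) : ℝ) := by exact_mod_cast h3
    push_cast at h2
    rw [Set.Ico_disjoint_Ico]
    refine (min_le_right _ _).trans (le_trans ?_ (le_max_left _ _))
    nlinarith

/-- Every finite family of dyadic intervals is covered by a pairwise disjoint subfamily. -/
theorem exists_disjoint_dyadic_cover (S : Finset (ℤ × ℤ)) :
    ∃ T ⊆ S, (T : Set (ℤ × ℤ)).PairwiseDisjoint dyadicI ∧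
      ∀ I ∈ S, ∃ J ∈ T, dyadicI I ⊆ dyadicI J := by
  classical
  induction S using Finset.induction_on with
  | empty => exact ⟨∅, by simp, by simp, by simp⟩
  | insert I S _ ih =>
    obtain ⟨T, hTS, hdisj, hcov⟩ := ih
    by_cases hI : ∃ J ∈ T, dyadicI I ⊆ dyadicI J
    · refine ⟨T, hTS.trans (Finset.subset_insert _ _), hdisj, fun K hK => ?_⟩
      rcases Finset.mem_insert.1 hK with rfl | hK
      · exact hI
      · exact hcov K hK
    · refine ⟨insert I (T.filter fun J => ¬ dyadicI J ⊆ dyadicI I),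
        Finset.insert_subset_insert _ ((Finset.filter_subset _ _).trans hTS), ?_, ?_⟩
      · rw [Finset.coe_insert, Set.pairwiseDisjoint_insert]
        refine ⟨hdisj.subset (Finset.coe_subset.2 (Finset.filter_subset _ _)), fun J hJ _ => ?_⟩
        have hJ' := Finset.mem_filter.1 (Finset.mem_coe.1 hJ)
        rcases le_total J.1 I.1 with h | h
        · exact (dyadicI_subset_or_disjoint_of_le h).resolve_left fun h' => hI ⟨J, hJ'.1, h'⟩
        · exact ((dyadicI_subset_or_disjoint_of_le h).resolve_left hJ'.2).symm
      · intro K hK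
        rcases Finset.mem_insert.1 hK with rfl | hK
        · exact ⟨K, Finset.mem_insert_self _ _, subset_rfl⟩
        · obtain ⟨J, hJ, hKJ⟩ := hcov K hK
          by_cases hJI : dyadicI J ⊆ dyadicI I
          · exact ⟨I, Finset.mem_insert_self _ _, hKJ.trans hJI⟩
          · exact ⟨J, Finset.mem_insert_of_mem (Finset.mem_filter.2 ⟨hJ, hJI⟩), hKJ⟩

/-- The sum of a Carleson sequence over a finite family is controlled by the measure of the
union of the family. -/
theorem sum_le_mul_volume_of_carleson {β : ℤ × ℤ → ℝ≥0∞} {Q : ℝ≥0∞}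
    (hβ : ∀ (J : ℤ × ℤ) (S : Finset (ℤ × ℤ)), (∀ I ∈ S, dyadicI I ⊆ dyadicI J) →
      ∑ I ∈ S, β I ≤ Q * volume (dyadicI J))
    (S : Finset (ℤ × ℤ)) {U : Set ℝ} (hU : ∀ I ∈ S, dyadicI I ⊆ U) :
    ∑ I ∈ S, β I ≤ Q * volume U := by
  classical
  obtain ⟨T, hTS, hdisj, hcov⟩ := exists_disjoint_dyadic_cover S
  calc ∑ I ∈ S, β I
      ≤ ∑ I ∈ S, ∑ J ∈ T, if dyadicI I ⊆ dyadicI J then β I else 0 := by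
        refine Finset.sum_le_sum fun I hI => ?_
        obtain ⟨J, hJ, hIJ⟩ := hcov I hI
        refine le_trans (le_of_eq ?_) (Finset.single_le_sum (fun _ _ => zero_le) hJ)
        rw [if_pos hIJ]
    _ = ∑ J ∈ T, ∑ I ∈ S.filter (fun I => dyadicI I ⊆ dyadicI J), β I := by
        rw [Finset.sum_comm]
        simp only [Finset.sum_filter]
    _ ≤ ∑ J ∈ T, Q * volume (dyadicI J) :=
        Finset.sum_le_sum fun J _ => hβ J _ fun I hI => (Finset.mem_filter.1 hI).2
    _ = Q * volume (⋃ J ∈ T, dyadicI J) := by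
        rw [measure_biUnion_finset hdisj fun J _ => measurableSet_dyadicI J, Finset.mul_sum]
    _ ≤ Q * volume U := by
        gcongr
        exact Set.iUnion₂_subset fun J hJ => hU J (hTS hJ)

/-- The dyadic Carleson embedding theorem, in `L¹` form. -/
theorem sum_mul_le_lintegral_of_carleson {β : ℤ × ℤ → ℝ≥0∞} {Q : ℝ≥0∞}
    (hβ : ∀ (J : ℤ × ℤ) (S : Finset (ℤ × ℤ)), (∀ I ∈ S, dyadicI I ⊆ dyadicI J) →
      ∑ I ∈ S, β I ≤ Q * volume (dyadicI J))
    (S : Finset (ℤ × ℤ)) {c : ℤ × ℤ → ℝ} {h : ℝ → ℝ} (h_meas : Measurable h)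
    (h_nonneg : 0 ≤ h) (hc : ∀ I ∈ S, ∀ x ∈ dyadicI I, c I ≤ h x) :
    ∑ I ∈ S, β I * ENNReal.ofReal (c I) ≤ Q * ∫⁻ x, ENNReal.ofReal (h x) := by
  have hlayer (r : ℝ) : ENNReal.ofReal r =
      ∫⁻ t in Ioi (0 : ℝ), (Iio r).indicator (fun _ => (1 : ℝ≥0∞)) t := by
    rw [lintegral_indicator_const measurableSet_Iio, one_mul,
      Measure.restrict_apply measurableSet_Iio, Set.inter_comm, Set.Ioi_inter_Iio,
      Real.volume_Ioo, sub_zero]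
  have hm (r : ℝ) : Measurable ((Iio r).indicator (fun _ => (1 : ℝ≥0∞))) :=
    measurable_const.indicator measurableSet_Iio
  have hm' : Measurable fun t : ℝ => volume {x | t < h x} :=
    Antitone.measurable fun s t hst => measure_mono fun x (hx : t < h x) => hst.trans_lt hx
  calc ∑ I ∈ S, β I * ENNReal.ofReal (c I)
      = ∫⁻ t in Ioi (0 : ℝ), ∑ I ∈ S, β I * (Iio (c I)).indicator (fun _ => (1 : ℝ≥0∞)) t := by
        rw [lintegral_finsetSum _ fun I _ => (hm _).const_mul _]
        refine Finset.sum_congr rfl fun I _ => ?_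
        rw [lintegral_const_mul _ (hm _), hlayer]
    _ ≤ ∫⁻ t in Ioi (0 : ℝ), Q * volume {x | t < h x} := by
        refine lintegral_mono fun t => ?_
        calc ∑ I ∈ S, β I * (Iio (c I)).indicator (fun _ => (1 : ℝ≥0∞)) t
            = ∑ I ∈ S.filter (fun I => t < c I), β I := by
              rw [Finset.sum_filter]
              refine Finset.sum_congr rfl fun I _ => ?_
              by_cases ht : t < c I <;> simp [Set.indicator, ht]
          _ ≤ Q * volume {x | t < h x} := by
              refine sum_le_mul_volume_of_carleson hβ _ fun I hI x hx => ?_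
              obtain ⟨hIS, ht⟩ := Finset.mem_filter.1 hI
              exact ht.trans_le (hc I hIS x hx)
    _ = Q * ∫⁻ x, ENNReal.ofReal (h x) := by
        rw [lintegral_const_mul _ hm',
          lintegral_eq_lintegral_meas_lt _ (.of_forall h_nonneg) h_meas.aemeasurable]

/-- The average of `φ` over `I` with respect to `μ`. -/
def measureAvg (μ : Measure ℝ) (φ : ℝ → ℝ≥0∞) (I : ℤ × ℤ) : ℝ≥0 :=
  ((∫⁻ x in dyadicI I, φ x ∂μ) / μ (dyadicI I)).toNNReal

/-- The dyadic maximal function of `φ` with respect to `μ`, over a finite family `S` of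
dyadic intervals. -/
def dyadicMax (μ : Measure ℝ) (φ : ℝ → ℝ≥0∞) (S : Finset (ℤ × ℤ)) (x : ℝ) : ℝ≥0 :=
  S.sup fun I => (dyadicI I).indicator (fun _ => measureAvg μ φ I) x

section Maximal

variable (μ : Measure ℝ) (φ : ℝ → ℝ≥0∞) (S : Finset (ℤ × ℤ))

theorem measurable_dyadicMax : Measurable (dyadicMax μ φ S) := by
  have : dyadicMax μ φ S =
      S.sup fun I => (dyadicI I).indicator (fun _ => measureAvg μ φ I) := by
    ext x
    simp [dyadicMax, Finset.sup_apply]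
  rw [this]
  exact Finset.sup_induction measurable_const (fun _ h _ h' => h.sup h')
    fun I _ => measurable_const.indicator (measurableSet_dyadicI I)

theorem measureAvg_le_dyadicMax {I : ℤ × ℤ} (hI : I ∈ S) {x : ℝ} (hx : x ∈ dyadicI I) :
    measureAvg μ φ I ≤ dyadicMax μ φ S x := by
  refine le_trans (le_of_eq ?_)
    (Finset.le_sup (f := fun I => (dyadicI I).indicator (fun _ => measureAvg μ φ I) x) hI)
  simp [hx]

theorem measureAvg_mul_le (I : ℤ × ℤ) :
    measureAvg μ φ I * μ (dyadicI I) ≤ ∫⁻ x in dyadicI I, φ x ∂μ :=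
  (mul_le_mul_left ENNReal.coe_toNNReal_le_self _).trans (by
    rw [mul_comm]
    exact ENNReal.mul_div_le)

/-- The weak-type inequality for the dyadic maximal function. -/
theorem mul_measure_dyadicMax_le (t : ℝ≥0) :
    t * μ {x | t < dyadicMax μ φ S x} ≤ μ.withDensity φ {x | t < dyadicMax μ φ S x} := by
  classical
  obtain ⟨T, hTS, hdisj, hcov⟩ :=
    exists_disjoint_dyadic_cover (S.filter fun I => t < measureAvg μ φ I)
  have hset : {x | t < dyadicMax μ φ S x} = ⋃ J ∈ T, dyadicI J := by
    ext x
    simp only [Set.mem_ofPred_eq, Set.mem_iUnion, exists_prop]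
    constructor
    · intro hx
      obtain ⟨I, hI, hIx⟩ := (Finset.lt_sup_iff).1 hx
      have hxI : x ∈ dyadicI I := by
        by_contra h
        simp [h] at hIx
      simp only [hxI, Set.indicator_of_mem] at hIx
      obtain ⟨J, hJ, hIJ⟩ := hcov I (Finset.mem_filter.2 ⟨hI, hIx⟩)
      exact ⟨J, hJ, hIJ hxI⟩
    · rintro ⟨J, hJ, hx⟩
      obtain ⟨hJS, ht⟩ := Finset.mem_filter.1 (hTS hJ)
      exact ht.trans_le (measureAvg_le_dyadicMax μ φ S hJS hx)
  rw [hset, measure_biUnion_finset hdisj fun J _ => measurableSet_dyadicI J,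
    measure_biUnion_finset hdisj fun J _ => measurableSet_dyadicI J, Finset.mul_sum]
  refine Finset.sum_le_sum fun J hJ => ?_
  rw [withDensity_apply _ (measurableSet_dyadicI J)]
  refine le_trans ?_ (measureAvg_mul_le μ φ J)
  gcongr
  exact (Finset.mem_filter.1 (hTS hJ)).2.le

variable {μ φ}

theorem lintegral_dyadicMax_sq_lt_top (hμ : ∀ I, μ (dyadicI I) ≠ ∞) :
    ∫⁻ x, (dyadicMax μ φ S x : ℝ≥0∞) ^ (2 : ℝ) ∂μ < ∞ := by
  calc ∫⁻ x, (dyadicMax μ φ S x : ℝ≥0∞) ^ (2 : ℝ) ∂μ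
      ≤ ∫⁻ x, ∑ I ∈ S, (dyadicI I).indicator
          (fun _ => (measureAvg μ φ I : ℝ≥0∞) ^ (2 : ℝ)) x ∂μ := by
        refine lintegral_mono fun x => ?_
        rcases S.eq_empty_or_nonempty with rfl | hS
        · simp [dyadicMax]
        · obtain ⟨I, hI, hx⟩ := Finset.exists_mem_eq_sup S hS
            fun I => (dyadicI I).indicator (fun _ => measureAvg μ φ I) x
          have hx' : dyadicMax μ φ S x = _ := hx
          refine le_trans (le_of_eq ?_) (Finset.single_le_sum (fun _ _ => zero_le) hI)
          rw [hx']
          by_cases hxI : x ∈ dyadicI I <;> simp [hxI]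
    _ = ∑ I ∈ S, (measureAvg μ φ I : ℝ≥0∞) ^ (2 : ℝ) * μ (dyadicI I) := by
        rw [lintegral_finsetSum _ fun I _ =>
          measurable_const.indicator (measurableSet_dyadicI I)]
        exact Finset.sum_congr rfl fun I _ =>
          lintegral_indicator_const (measurableSet_dyadicI I) _
    _ < ∞ := ENNReal.sum_lt_top.2 fun I _ => ENNReal.mul_lt_top
        (ENNReal.rpow_lt_top_of_nonneg (by norm_num) ENNReal.coe_ne_top) (hμ I).lt_top

/-- The `L²` bound for the dyadic maximal function with respect to an arbitrary measure. -/
theorem lintegral_dyadicMax_sq_le (hμ : ∀ I, μ (dyadicI I) ≠ ∞) (hφ : AEMeasurable φ μ) :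
    (∫⁻ x, (dyadicMax μ φ S x : ℝ≥0∞) ^ (2 : ℝ) ∂μ) ^ (1 / 2 : ℝ) ≤
      2 * (∫⁻ x, φ x ^ (2 : ℝ) ∂μ) ^ (1 / 2 : ℝ) := by
  have hM := measurable_dyadicMax μ φ S
  have hM' : Measurable fun x => (dyadicMax μ φ S x : ℝ) := hM.coe_nnreal_real
  have key : ∫⁻ x, (dyadicMax μ φ S x : ℝ≥0∞) ^ (2 : ℝ) ∂μ ≤
      2 * ((∫⁻ x, φ x ^ (2 : ℝ) ∂μ) ^ (1 / 2 : ℝ) *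
        (∫⁻ x, (dyadicMax μ φ S x : ℝ≥0∞) ^ (2 : ℝ) ∂μ) ^ (1 / 2 : ℝ)) :=
    calc ∫⁻ x, (dyadicMax μ φ S x : ℝ≥0∞) ^ (2 : ℝ) ∂μ
        = ∫⁻ x, ENNReal.ofReal ((dyadicMax μ φ S x : ℝ) ^ (2 : ℝ)) ∂μ := by
          refine lintegral_congr fun x => ?_
          rw [← ENNReal.ofReal_rpow_of_nonneg (NNReal.coe_nonneg _) (by norm_num),
            ENNReal.ofReal_coe_nnreal]
      _ = 2 * ∫⁻ t in Ioi (0 : ℝ), μ {x | t < (dyadicMax μ φ S x : ℝ)} *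
            ENNReal.ofReal (t ^ ((2 : ℝ) - 1)) := by
          rw [lintegral_rpow_eq_lintegral_meas_lt_mul μ
            (.of_forall fun x => NNReal.coe_nonneg _) hM'.aemeasurable (by norm_num)]
          norm_num
      _ ≤ 2 * ∫⁻ t in Ioi (0 : ℝ), μ.withDensity φ {x | t < (dyadicMax μ φ S x : ℝ)} := by
          gcongr 2 * ?_
          refine setLIntegral_mono' measurableSet_Ioi fun t (ht : 0 < t) => ?_
          lift t to ℝ≥0 using ht.le
          have := mul_measure_dyadicMax_le μ φ S t
          norm_num
          rwa [mul_comm]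
      _ = 2 * ∫⁻ x, dyadicMax μ φ S x ∂(μ.withDensity φ) := by
          rw [← lintegral_eq_lintegral_meas_lt _ (.of_forall fun x => NNReal.coe_nonneg _)
            hM'.aemeasurable]
          simp
      _ = 2 * ∫⁻ x, (φ * fun x => (dyadicMax μ φ S x : ℝ≥0∞)) x ∂μ := by
          rw [lintegral_withDensity_eq_lintegral_mul₀ hφ hM.coe_nnreal_ennreal.aemeasurable]
      _ ≤ _ := by
          gcongr
          exact ENNReal.lintegral_mul_le_Lp_mul_Lq μ Real.HolderConjugate.two_two hφ
            hM.coe_nnreal_ennreal.aemeasurable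
  have hfin := lintegral_dyadicMax_sq_lt_top (φ := φ) S hμ
  set X := ∫⁻ x, (dyadicMax μ φ S x : ℝ≥0∞) ^ (2 : ℝ) ∂μ
  rcases eq_or_ne X 0 with h0 | h0
  · simp [h0]
  have hX : X = X ^ (1 / 2 : ℝ) * X ^ (1 / 2 : ℝ) := by
    rw [← ENNReal.rpow_add _ _ h0 hfin.ne]
    norm_num
  rw [← mul_assoc] at key
  nth_rewrite 1 [hX] at key
  refine (ENNReal.mul_le_mul_iff_left ?_ ?_).1 key
  · simp [h0, hfin.ne]
  · simp [h0, hfin.ne]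

/-- The averages recover the integrals when `φ` is square integrable. -/
theorem setLIntegral_le_measureAvg_mul (hμ : ∀ I, μ (dyadicI I) ≠ ∞)
    (hφ₂ : ∫⁻ x, φ x ^ (2 : ℝ) ∂μ ≠ ∞) (I : ℤ × ℤ) :
    ∫⁻ x in dyadicI I, φ x ∂μ ≤ measureAvg μ φ I * μ (dyadicI I) := by
  rcases eq_or_ne (μ (dyadicI I)) 0 with h0 | h0
  · simp [Measure.restrict_eq_zero.2 h0]
  have hfin : ∫⁻ x in dyadicI I, φ x ∂μ < ∞ := by
    calc ∫⁻ x in dyadicI I, φ x ∂μ ≤ ∫⁻ x in dyadicI I, (1 + φ x ^ (2 : ℝ)) ∂μ := by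
          refine lintegral_mono fun x => ?_
          rcases le_total (φ x) 1 with h | h
          · exact h.trans le_self_add
          · refine le_trans ?_ le_add_self
            simpa using ENNReal.rpow_le_rpow_of_exponent_le h (by norm_num : (1 : ℝ) ≤ 2)
      _ = μ (dyadicI I) + ∫⁻ x in dyadicI I, φ x ^ (2 : ℝ) ∂μ := by
          rw [lintegral_add_left measurable_const]
          simp
      _ < ∞ := ENNReal.add_lt_top.2
          ⟨(hμ I).lt_top, (setLIntegral_le_lintegral _ _).trans_lt hφ₂.lt_top⟩
  rw [measureAvg, ENNReal.coe_toNNReal (ENNReal.div_ne_top hfin.ne h0),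
    ENNReal.div_mul_cancel h0 (hμ I)]

end Maximal

/-- The measure with density `v`. -/
def weightMeasure (v : ℝ → ℝ) : Measure ℝ := volume.withDensity fun x => ENNReal.ofReal (v x)

/-- The function `f v^{-1/2}`, with values in `ℝ≥0∞`. -/
def weightQuot (v f : ℝ → ℝ) (x : ℝ) : ℝ≥0∞ := ENNReal.ofReal (|f x| * (√(v x))⁻¹)

section Weight

variable {v f : ℝ → ℝ}

theorem integrableOn_dyadicI (hv : LocallyIntegrable v) (I : ℤ × ℤ) :
    IntegrableOn v (dyadicI I) :=
  (hv.integrableOn_isCompact isCompact_Icc).mono_set Set.Ico_subset_Icc_self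

theorem weightMeasure_dyadicI (hpos : ∀ x, 0 < v x) (hv : LocallyIntegrable v) (I : ℤ × ℤ) :
    weightMeasure v (dyadicI I) = ENNReal.ofReal (∫ x in dyadicI I, v x) := by
  rw [weightMeasure, withDensity_apply _ (measurableSet_dyadicI I),
    ofReal_integral_eq_lintegral_ofReal (integrableOn_dyadicI hv I)
      (.of_forall fun x => (hpos x).le)]

theorem aemeasurable_weightQuot (hv : LocallyIntegrable v) (hf : Measurable f) :
    AEMeasurable (weightQuot v f) := by
  have := hv.aestronglyMeasurable.aemeasurable
  unfold weightQuot
  fun_prop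

theorem lintegral_weightQuot_sq (hpos : ∀ x, 0 < v x) (hv : LocallyIntegrable v)
    (hf : Measurable f) (hf₂ : Integrable fun x => f x ^ 2) :
    ∫⁻ x, weightQuot v f x ^ (2 : ℝ) ∂(weightMeasure v) = ENNReal.ofReal (∫ x, f x ^ 2) := by
  have hvm := hv.aestronglyMeasurable.aemeasurable
  rw [weightMeasure, lintegral_withDensity_eq_lintegral_mul₀ hvm.ennreal_ofReal
    ((aemeasurable_weightQuot hv hf).pow_const _),
    ofReal_integral_eq_lintegral_ofReal hf₂ (.of_forall fun x => sq_nonneg _)]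
  refine lintegral_congr fun x => ?_
  have hx := hpos x
  simp only [Pi.mul_apply, weightQuot]
  rw [ENNReal.ofReal_rpow_of_nonneg (by positivity) (by norm_num), ← ENNReal.ofReal_mul hx.le]
  congr 1
  rw [Real.rpow_two, mul_pow, inv_pow, Real.sq_sqrt hx.le, sq_abs]
  field_simp

theorem setLIntegral_weightQuot (hpos : ∀ x, 0 < v x) (hv : LocallyIntegrable v)
    (hf : Measurable f) (I : ℤ × ℤ) :
    ∫⁻ x in dyadicI I, weightQuot v f x ∂(weightMeasure v) =
      ∫⁻ x in dyadicI I, ‖f x * √(v x)‖ₑ := by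
  have hvm := hv.aestronglyMeasurable.aemeasurable
  rw [weightMeasure, restrict_withDensity (measurableSet_dyadicI I),
    lintegral_withDensity_eq_lintegral_mul₀ hvm.restrict.ennreal_ofReal
      (aemeasurable_weightQuot hv hf).restrict]
  refine lintegral_congr fun x => ?_
  have hx := hpos x
  simp only [Pi.mul_apply, weightQuot]
  rw [← ENNReal.ofReal_mul hx.le, ← ofReal_norm]
  congr 1
  rw [norm_mul, Real.norm_eq_abs, Real.norm_eq_abs, abs_of_nonneg (Real.sqrt_nonneg _)]
  have hs := Real.sqrt_pos.2 hx
  nth_rewrite 1 [← Real.mul_self_sqrt hx.le]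
  field_simp

theorem abs_avg_mul_sqrt_le (hpos : ∀ x, 0 < v x) (hv : LocallyIntegrable v)
    (hf : Measurable f) (hf₂ : Integrable fun x => f x ^ 2) (I : ℤ × ℤ) :
    |avg (fun x => f x * √(v x)) I| ≤
      measureAvg (weightMeasure v) (weightQuot v f) I * avg v I := by
  have hμ (I : ℤ × ℤ) : weightMeasure v (dyadicI I) ≠ ∞ := by
    rw [weightMeasure_dyadicI hpos hv]
    exact ENNReal.ofReal_ne_top
  have h := setLIntegral_le_measureAvg_mul (φ := weightQuot v f) hμ (by
    rw [lintegral_weightQuot_sq hpos hv hf hf₂]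
    exact ENNReal.ofReal_ne_top) I
  rw [setLIntegral_weightQuot hpos hv hf, weightMeasure_dyadicI hpos hv] at h
  have hle := (enorm_integral_le_lintegral_enorm _).trans h
  rw [← ofReal_norm, ← ENNReal.ofReal_coe_nnreal,
    ← ENNReal.ofReal_mul (NNReal.coe_nonneg _), ENNReal.ofReal_le_ofReal_iff (mul_nonneg
      (NNReal.coe_nonneg _) (integral_nonneg fun x => (hpos x).le)), Real.norm_eq_abs] at hle
  have hl := inv_pos.2 (len_pos I)
  rw [avg, abs_mul, abs_of_pos hl, avg, mul_left_comm]
  exact mul_le_mul_of_nonneg_left hle hl.le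

/-- The weighted `L²` bound for the dyadic maximal function, as an unweighted integral. -/
theorem lintegral_dyadicMax_mul_sqrt_sq_le (hpos : ∀ x, 0 < v x) (hv : LocallyIntegrable v)
    (hf : Measurable f) (hf₂ : Integrable fun x => f x ^ 2) (S : Finset (ℤ × ℤ)) :
    (∫⁻ x, (dyadicMax (weightMeasure v) (weightQuot v f) S x *
      ENNReal.ofReal (√(v x))) ^ (2 : ℝ)) ^ (1 / 2 : ℝ) ≤
      ENNReal.ofReal (2 * √(∫ x, f x ^ 2)) := by
  have hvm := hv.aestronglyMeasurable.aemeasurable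
  have hμ (I : ℤ × ℤ) : weightMeasure v (dyadicI I) ≠ ∞ := by
    rw [weightMeasure_dyadicI hpos hv]
    exact ENNReal.ofReal_ne_top
  have h := lintegral_dyadicMax_sq_le S hμ
    ((aemeasurable_weightQuot hv hf).mono_ac (withDensity_absolutelyContinuous _ _))
  rw [lintegral_weightQuot_sq hpos hv hf hf₂, ENNReal.ofReal_rpow_of_nonneg
    (integral_nonneg fun x => sq_nonneg _) (by norm_num), ← Real.sqrt_eq_rpow] at h
  rw [ENNReal.ofReal_mul (by norm_num), ENNReal.ofReal_ofNat]
  convert h using 2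
  generalize hM : dyadicMax (weightMeasure v) (weightQuot v f) S = M
  have hMm : Measurable M := hM ▸ measurable_dyadicMax _ _ _
  rw [weightMeasure, lintegral_withDensity_eq_lintegral_mul₀ hvm.ennreal_ofReal
    (hMm.coe_nnreal_ennreal.pow_const _).aemeasurable]
  refine lintegral_congr fun x => ?_
  rw [ENNReal.mul_rpow_of_nonneg _ _ (by norm_num), Pi.mul_apply, mul_comm,
    ENNReal.ofReal_rpow_of_nonneg (Real.sqrt_nonneg _) (by norm_num), Real.rpow_two,
    Real.sq_sqrt (hpos x).le]

end Weight

/-- Petermichl's bilinear embedding theorem: if `‖w‖_{A₂^d} ≤ Q` and the nonnegative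
sequence `{α_I}` satisfies the three Carleson-type conditions with constant `Q`, then
`Σ_{I∈D} α_I m_I(f w^{-1/2}) m_I(g w^{1/2}) ≤ C Q ‖f‖_{L₂} ‖g‖_{L₂}`. -/
theorem bilinear_embedding
    : ∃ C : ℝ, 0 < C ∧ ∀ (w : ℝ → ℝ) (Q : ℝ), (∀ x, 0 < w x) →
      LocallyIntegrable w volume →
      LocallyIntegrable (fun x => (w x)⁻¹) volume →
      (∀ I : ℤ × ℤ, avg w I * avg (fun x => (w x)⁻¹) I ≤ Q) →
      ∀ (α : ℤ × ℤ → ℝ), (∀ I, 0 ≤ α I) →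
      (∀ (J : ℤ × ℤ) (S : Finset (ℤ × ℤ)), (∀ I ∈ S, dyadicI I ⊆ dyadicI J) →
        (len J)⁻¹ * ∑ I ∈ S, α I * (avg w I * avg (fun x => (w x)⁻¹) I) ≤ Q) →
      (∀ (J : ℤ × ℤ) (S : Finset (ℤ × ℤ)), (∀ I ∈ S, dyadicI I ⊆ dyadicI J) →
        (len J)⁻¹ * ∑ I ∈ S, α I * avg w I ≤ Q * avg w J) →
      (∀ (J : ℤ × ℤ) (S : Finset (ℤ × ℤ)), (∀ I ∈ S, dyadicI I ⊆ dyadicI J) →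
        (len J)⁻¹ * ∑ I ∈ S, α I * avg (fun x => (w x)⁻¹) I
          ≤ Q * avg (fun x => (w x)⁻¹) J) →
      ∀ (f g : ℝ → ℝ), Measurable f → Integrable (fun x => (f x) ^ 2) →
        Measurable g → Integrable (fun x => (g x) ^ 2) →
        ∀ S : Finset (ℤ × ℤ),
          ∑ I ∈ S, α I * avg (fun x => f x * (Real.sqrt (w x))⁻¹) I *
              avg (fun x => g x * Real.sqrt (w x)) I
            ≤ C * Q * Real.sqrt (∫ x, (f x) ^ 2) * Real.sqrt (∫ x, (g x) ^ 2) := by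
  refine ⟨4, by norm_num, ?_⟩
  intro w Q hpos hw hσ hA2 α hα hcarl _ _ f g hf hf₂ hg hg₂ S
  have hpos' (x : ℝ) : 0 < (w x)⁻¹ := inv_pos.2 (hpos x)
  have havg {v : ℝ → ℝ} (hv : ∀ x, 0 < v x) (I : ℤ × ℤ) : 0 ≤ avg v I :=
    mul_nonneg (inv_pos.2 (len_pos I)).le (integral_nonneg fun x => (hv x).le)
  have hQ : 0 ≤ Q := (mul_nonneg (havg hpos (0, 0)) (havg hpos' (0, 0))).trans (hA2 _)
  set a := measureAvg (weightMeasure fun x => (w x)⁻¹) (weightQuot (fun x => (w x)⁻¹) f)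
  set b := measureAvg (weightMeasure w) (weightQuot w g)
  set M := dyadicMax (weightMeasure fun x => (w x)⁻¹) (weightQuot (fun x => (w x)⁻¹) f) S
  set N := dyadicMax (weightMeasure w) (weightQuot w g) S
  set β : ℤ × ℤ → ℝ := fun I => α I * (avg w I * avg (fun x => (w x)⁻¹) I)
  have hβ (I : ℤ × ℤ) : 0 ≤ β I := mul_nonneg (hα I) (mul_nonneg (havg hpos I) (havg hpos' I))
  have hMm : Measurable M := measurable_dyadicMax _ _ _
  have hNm : Measurable N := measurable_dyadicMax _ _ _
  have hterm : ∑ I ∈ S, α I * avg (fun x => f x * (√(w x))⁻¹) I *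
      avg (fun x => g x * √(w x)) I ≤ ∑ I ∈ S, β I * (a I * b I) := by
    refine Finset.sum_le_sum fun I _ => ?_
    have h1 := abs_avg_mul_sqrt_le hpos' hσ hf hf₂ I
    have h2 := abs_avg_mul_sqrt_le hpos hw hg hg₂ I
    simp only [Real.sqrt_inv] at h1
    calc α I * avg (fun x => f x * (√(w x))⁻¹) I * avg (fun x => g x * √(w x)) I
        = α I * (avg (fun x => f x * (√(w x))⁻¹) I * avg (fun x => g x * √(w x)) I) := by ring
      _ ≤ α I * (|avg (fun x => f x * (√(w x))⁻¹) I| * |avg (fun x => g x * √(w x)) I|) := by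
          rw [← abs_mul]
          exact mul_le_mul_of_nonneg_left (le_abs_self _) (hα I)
      _ ≤ α I * ((a I * avg (fun x => (w x)⁻¹) I) * (b I * avg w I)) :=
          mul_le_mul_of_nonneg_left (mul_le_mul h1 h2 (abs_nonneg _)
            (mul_nonneg (NNReal.coe_nonneg _) (havg hpos' I))) (hα I)
      _ = β I * (a I * b I) := by
          simp only [β]
          ring
  have hembed : ∑ I ∈ S, ENNReal.ofReal (β I) * ENNReal.ofReal (a I * b I) ≤
      ENNReal.ofReal Q * ∫⁻ x, ENNReal.ofReal (M x * N x) := by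
    refine sum_mul_le_lintegral_of_carleson (fun J T hT => ?_) S
      (hMm.coe_nnreal_real.mul hNm.coe_nnreal_real)
      (fun x => mul_nonneg (NNReal.coe_nonneg _) (NNReal.coe_nonneg _)) fun I hI x hx => ?_
    · rw [volume_dyadicI, ← ENNReal.ofReal_mul hQ, ← ENNReal.ofReal_sum_of_nonneg fun I _ => hβ I]
      refine ENNReal.ofReal_le_ofReal ?_
      have h := hcarl J T hT
      rwa [inv_mul_le_iff₀ (len_pos J), mul_comm] at h
    · exact_mod_cast mul_le_mul' (measureAvg_le_dyadicMax _ _ S hI hx)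
        (measureAvg_le_dyadicMax _ _ S hI hx)
  have hholder : ∫⁻ x, ENNReal.ofReal (M x * N x) ≤
      ENNReal.ofReal (2 * √(∫ x, f x ^ 2)) * ENNReal.ofReal (2 * √(∫ x, g x ^ 2)) := by
    have hwm := hw.aestronglyMeasurable.aemeasurable
    calc ∫⁻ x, ENNReal.ofReal (M x * N x)
        = ∫⁻ x, ((fun x => M x * ENNReal.ofReal (√((w x)⁻¹))) *
            fun x => N x * ENNReal.ofReal (√(w x))) x := by
          refine lintegral_congr fun x => ?_
          have hs := Real.sqrt_pos.2 (hpos x)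
          have h1 : ENNReal.ofReal (√((w x)⁻¹)) * ENNReal.ofReal (√(w x)) = 1 := by
            rw [← ENNReal.ofReal_mul (Real.sqrt_nonneg _), Real.sqrt_inv,
              inv_mul_cancel₀ hs.ne', ENNReal.ofReal_one]
          rw [Pi.mul_apply, mul_mul_mul_comm, h1, mul_one,
            ENNReal.ofReal_mul (NNReal.coe_nonneg _)]
          simp
      _ ≤ _ := ENNReal.lintegral_mul_le_Lp_mul_Lq volume Real.HolderConjugate.two_two
          (by fun_prop) (by fun_prop)
      _ ≤ _ := mul_le_mul' (lintegral_dyadicMax_mul_sqrt_sq_le hpos' hσ hf hf₂ S)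
          (lintegral_dyadicMax_mul_sqrt_sq_le hpos hw hg hg₂ S)
  refine hterm.trans ((ENNReal.ofReal_le_ofReal_iff (by positivity)).1 ?_)
  rw [ENNReal.ofReal_sum_of_nonneg fun I _ =>
    mul_nonneg (hβ I) (mul_nonneg (NNReal.coe_nonneg _) (NNReal.coe_nonneg _))]
  simp only [ENNReal.ofReal_mul (hβ _)]
  refine hembed.trans ((mul_le_mul_right hholder _).trans (le_of_eq ?_))
  rw [← ENNReal.ofReal_mul (by positivity), ← ENNReal.ofReal_mul hQ]
  congr 1
  ring
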